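/- arXiv:1410.3121 — 11 statements merged into one kernel-verified Lean document; each statement's English description precedes it below -/
import Mathlib

section
/- Every local ring (a nonzero ring, not necessarily commutative, in which the non-units form an additive subgroup, equivalently the non-units coincide with the Jacobson radical) is both right J-McCoy and left J-McCoy. -/
/-- A ring `R` is *right J-McCoy* if whenever `f, g` are nonzero polynomials over `R` with
`f * g = 0`, there is a nonzero `r : R` with all coefficients of `f` multiplied by `r` on the
right lying in the Jacobson radical of `R` (the intersection of all maximal left ideals). -/
def IsRightJMcCoy (R : Type*) [Ring R] : Prop :=
  ∀ f g : Polynomial R, f ≠ 0 → g ≠ 0 → f * g = 0 →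
    ∃ r : R, r ≠ 0 ∧ ∀ i : ℕ, f.coeff i * r ∈ (⊥ : Ideal R).jacobson

/-- A ring `R` is *left J-McCoy* if whenever `f, g` are nonzero polynomials over `R` with
`f * g = 0`, there is a nonzero `r : R` with `r` times each coefficient of `g` lying in the
Jacobson radical of `R`. -/
def IsLeftJMcCoy (R : Type*) [Ring R] : Prop :=
  ∀ f g : Polynomial R, f ≠ 0 → g ≠ 0 → f * g = 0 →
    ∃ r : R, r ≠ 0 ∧ ∀ j : ℕ, r * g.coeff j ∈ (⊥ : Ideal R).jacobson

theorem isUnit_of_left_inv_of_isLocalRing {R : Type*} [Ring R] [IsLocalRing R] {w x : R}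
    (h : w * x = 1) : IsUnit x := by
  rcases IsLocalRing.isUnit_or_isUnit_of_add_one (add_sub_cancel (x * w) 1) with hu | hu
  · have h1 : x * w = 1 := by
      apply hu.mul_left_cancel
      rw [mul_one, mul_assoc, ← mul_assoc w, h, one_mul]
    exact ⟨⟨x, w, h1, h⟩, rfl⟩
  · exfalso
    have h1 : x = 0 := by
      apply hu.mul_left_cancel
      rw [mul_zero, sub_mul, mul_assoc, h, one_mul, mul_one, sub_self]
    rw [h1, mul_zero] at h
    exact zero_ne_one h

theorem mem_jacobson_of_not_isUnit {R : Type*} [Ring R] [IsLocalRing R] {x : R}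
    (hx : ¬ IsUnit x) : x ∈ (⊥ : Ideal R).jacobson := by
  rw [Ideal.mem_jacobson_iff]
  intro y
  have h1 : ¬ IsUnit (-(y * x)) := by
    intro hu
    rw [IsUnit.neg_iff] at hu
    obtain ⟨u, hu⟩ := hu
    apply hx
    apply isUnit_of_left_inv_of_isLocalRing (w := (↑u⁻¹ : R) * y)
    rw [mul_assoc, ← hu, Units.inv_mul]
  have h2 : IsUnit (1 - -(y * x)) :=
    (IsLocalRing.isUnit_or_isUnit_of_add_one (add_sub_cancel _ 1)).resolve_left h1
  obtain ⟨u, hu⟩ := h2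
  refine ⟨(↑u⁻¹ : R), ?_⟩
  have h3 : (↑u⁻¹ : R) * (1 - -(y * x)) = 1 := by rw [← hu, Units.inv_mul]
  rw [Ideal.mem_bot, ← h3]
  noncomm_ring

/-- Every local ring is right and left J-McCoy. -/
theorem isRightJMcCoy_and_isLeftJMcCoy_of_isLocalRing (R : Type*) [Ring R] [IsLocalRing R] :
    IsRightJMcCoy R ∧ IsLeftJMcCoy R := by
  by_cases h : ∃ r : R, r ≠ 0 ∧ r ∈ (⊥ : Ideal R).jacobson
  · obtain ⟨r, hr, hJ⟩ := h
    exact ⟨fun f g _ _ _ => ⟨r, hr, fun i => Ideal.mul_mem_left _ _ hJ⟩,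
      fun f g _ _ _ => ⟨r, hr, fun i => Ideal.mul_mem_right _ _ hJ⟩⟩
  · have hd : NoZeroDivisors R := ⟨by
      intro a b hab
      by_cases ha : IsUnit a
      · right
        exact ha.mul_left_cancel (by rw [hab, mul_zero])
      · left
        by_contra h0
        exact h ⟨a, h0, mem_jacobson_of_not_isUnit ha⟩⟩
    exact ⟨fun f g hf hg hfg => absurd hfg (mul_ne_zero hf hg),
      fun f g hf hg hfg => absurd hfg (mul_ne_zero hf hg)⟩
end

section
/- Let R be a ring and I a two-sided ideal of R with I ⊆ J(R). If the quotient ring R/I is left J-McCoy, then R is left J-McCoy. -/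
/-- If `I` is a two-sided ideal of `R` contained in the Jacobson radical of `R` and the
quotient ring `R/I` is left J-McCoy, then `R` is left J-McCoy. -/
theorem isLeftJMcCoy_of_quotient (R : Type*) [Ring R] (I : TwoSidedIdeal R)
    (hI : ∀ x ∈ I, x ∈ (⊥ : Ideal R).jacobson)
    (h : IsLeftJMcCoy I.ringCon.Quotient) :
    IsLeftJMcCoy R := by
  classical
  intro f g hf hg hfg
  let q : R →+* I.ringCon.Quotient := I.ringCon.mk'
  have hq : Function.Surjective q := I.ringCon.mk'_surjective
  have hker : ∀ x, q x = 0 → x ∈ (⊥ : Ideal R).jacobson := by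
    intro x hx
    apply hI
    rw [TwoSidedIdeal.mem_iff]
    exact (RingCon.eq I.ringCon).1 hx
  by_cases hf0 : f.map q = 0
  · obtain ⟨n, hn⟩ : ∃ n, f.coeff n ≠ 0 := by
      by_contra! hc
      exact hf (Polynomial.ext (by simpa using hc))
    refine ⟨f.coeff n, hn, fun j => ?_⟩
    have h1 : f.coeff n ∈ (⊥ : Ideal R).jacobson := by
      apply hker
      rw [← Polynomial.coeff_map, hf0, Polynomial.coeff_zero]
    exact Ideal.mul_mem_right _ _ h1
  by_cases hg0 : g.map q = 0
  · have : Nontrivial R := Polynomial.nontrivial_iff.1 ⟨f, 0, hf⟩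
    refine ⟨1, one_ne_zero, fun j => ?_⟩
    rw [one_mul]
    apply hker
    rw [← Polynomial.coeff_map, hg0, Polynomial.coeff_zero]
  obtain ⟨r', hr', hr⟩ := h (f.map q) (g.map q) hf0 hg0
    (by rw [← Polynomial.map_mul, hfg, Polynomial.map_zero])
  obtain ⟨r, rfl⟩ := hq r'
  refine ⟨r, fun h0 => hr' (by rw [h0, map_zero]), fun j => ?_⟩
  have h2 := hr j
  rw [Polynomial.coeff_map, ← map_mul, ← Ideal.mem_comap,
    Ideal.comap_jacobson_of_surjective hq] at h2
  have hle : Ideal.comap q ⊥ ≤ (⊥ : Ideal R).jacobson := fun x hx => hker x (by simpa using hx)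
  have h3 := Ideal.jacobson_mono hle h2
  rwa [Ideal.jacobson_idem] at h3
end

section
/- Let (R_k)_{k ∈ I} be a family of rings. If every R_k is right J-McCoy, then the direct product ring ∏_{k ∈ I} R_k (with componentwise operations) is right J-McCoy. -/
/-- If every member of a family of rings is right J-McCoy, then so is their direct product. -/
theorem isRightJMcCoy_pi {ι : Type*} (R : ι → Type*) [∀ k, Ring (R k)]
    (h : ∀ k, IsRightJMcCoy (R k)) : IsRightJMcCoy (∀ k, R k) := by
  classical
  intro f g _ hg hfg
  obtain ⟨n, hn⟩ : ∃ n, g.coeff n ≠ 0 := by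
    by_contra! hc
    exact hg (Polynomial.ext (by simpa using hc))
  obtain ⟨k, hk⟩ : ∃ k, g.coeff n k ≠ 0 := by
    by_contra! hc
    exact hn (funext hc)
  have key : ∃ r : R k, r ≠ 0 ∧ ∀ i : ℕ, f.coeff i k * r ∈ (⊥ : Ideal (R k)).jacobson := by
    by_cases hf : f.map (Pi.evalRingHom R k) = 0
    · refine ⟨g.coeff n k, hk, fun i => ?_⟩
      have h0 : f.coeff i k = 0 := by
        simpa using congrArg (fun p => Polynomial.coeff p i) hf
      rw [h0, zero_mul]
      exact Submodule.zero_mem _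
    · obtain ⟨r, hr, hm⟩ := h k (f.map (Pi.evalRingHom R k)) (g.map (Pi.evalRingHom R k)) hf
        (fun h0 => hk (by simpa using congrArg (fun p => Polynomial.coeff p n) h0))
        (by rw [← Polynomial.map_mul, hfg, Polynomial.map_zero])
      exact ⟨r, hr, fun i => by simpa using hm i⟩
  obtain ⟨r, hr, hm⟩ := key
  refine ⟨Pi.single k r, fun h0 => hr (by simpa using congrFun h0 k), fun i => ?_⟩
  rw [Ideal.mem_jacobson_iff]
  intro y
  obtain ⟨z, hz⟩ := Ideal.mem_jacobson_iff.1 (hm i) (y k)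
  refine ⟨Function.update 1 k z, ?_⟩
  rw [Ideal.mem_bot] at hz ⊢
  funext j
  by_cases hj : j = k
  · subst hj
    simpa using hz
  · simp [hj]
end

section
/- Let (R_k)_{k ∈ I} be a family of rings. If every R_k is left J-McCoy, then the direct product ring ∏_{k ∈ I} R_k (with componentwise operations) is left J-McCoy. -/
/-- If every member of a family of rings is left J-McCoy, then so is their direct product. -/
theorem isLeftJMcCoy_pi {ι : Type*} (R : ι → Type*) [∀ k, Ring (R k)]
    (h : ∀ k, IsLeftJMcCoy (R k)) : IsLeftJMcCoy (∀ k, R k) := by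
  classical
  intro f g hf hg hfg
  obtain ⟨n, hn⟩ : ∃ n, f.coeff n ≠ 0 := by
    by_contra hc
    push Not at hc
    exact hf (Polynomial.ext (by simpa using hc))
  obtain ⟨k, hk⟩ := Function.ne_iff.mp hn
  have hfk : f.map (Pi.evalRingHom R k) ≠ 0 := by
    intro h0
    apply hk
    have := congrArg (fun p => Polynomial.coeff p n) h0
    simpa using this
  have key : ∃ r : R k, r ≠ 0 ∧ ∀ j : ℕ, r * g.coeff j k ∈ (⊥ : Ideal (R k)).jacobson := by
    by_cases hgk : g.map (Pi.evalRingHom R k) = 0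
    · refine ⟨f.coeff n k, hk, fun j => ?_⟩
      have := congrArg (fun p => Polynomial.coeff p j) hgk
      have h0 : g.coeff j k = 0 := by simpa using this
      rw [h0, mul_zero]
      exact zero_mem _
    · obtain ⟨r, hr, hj⟩ := h k _ _ hfk hgk (by rw [← Polynomial.map_mul, hfg, Polynomial.map_zero])
      exact ⟨r, hr, fun j => by simpa using hj j⟩
  obtain ⟨r, hr, hj⟩ := key
  refine ⟨Pi.single k r, by simpa using hr, fun j => ?_⟩
  rw [Ideal.mem_jacobson_iff]
  intro y
  obtain ⟨z, hz⟩ := Ideal.mem_jacobson_iff.mp (hj j) (y k)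
  refine ⟨Function.update 1 k z, ?_⟩
  rw [Ideal.mem_bot] at hz ⊢
  funext i
  by_cases hi : i = k
  · subst hi
    simpa using hz
  · simp [hi]
end

section
/- Let D be a ring and C a subring of D containing the identity of D. Let R(D,C) be the subring of the direct product ∏_{n ∈ ℕ} D consisting of all sequences (d_1, …, d_n, c, c, c, …) that are eventually constant with constant value c lying in C (with componentwise addition and multiplication). Then D is right J-McCoy if and only if R(D,C) is right J-McCoy. -/
/-- `R(D,C)`: the subring of the direct product `∏_{n ∈ ℕ} D` consisting of the sequences
that are eventually constant, with eventual value lying in the subring `C` of `D`. -/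
def eventuallyConstantSubring (D : Type*) [Ring D] (C : Subring D) : Subring (ℕ → D) where
  carrier := {f | ∃ c ∈ C, ∃ N : ℕ, ∀ n ≥ N, f n = c}
  zero_mem' := ⟨0, C.zero_mem, 0, fun _ _ => rfl⟩
  one_mem' := ⟨1, C.one_mem, 0, fun _ _ => rfl⟩
  add_mem' := by
    rintro f g ⟨c, hc, N, hN⟩ ⟨c', hc', N', hN'⟩
    exact ⟨c + c', C.add_mem hc hc', max N N', fun n hn => by
      simp [hN n (le_of_max_le_left hn), hN' n (le_of_max_le_right hn)]⟩
  mul_mem' := by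
    rintro f g ⟨c, hc, N, hN⟩ ⟨c', hc', N', hN'⟩
    exact ⟨c * c', C.mul_mem hc hc', max N N', fun n hn => by
      simp [hN n (le_of_max_le_left hn), hN' n (le_of_max_le_right hn)]⟩
  neg_mem' := by
    rintro f ⟨c, hc, N, hN⟩
    exact ⟨-c, C.neg_mem hc, N, fun n hn => by simp [hN n hn]⟩

namespace ECS

variable {D : Type*} [Ring D] {C : Subring D}

/-- The sequence with `d` in position `n` and zeros elsewhere. -/
def sg (C : Subring D) (n : ℕ) (d : D) : eventuallyConstantSubring D C :=
  ⟨Pi.single n d, 0, C.zero_mem, n + 1, fun m hm => by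
    have h : m ≠ n := by omega
    simp [h]⟩

lemma sg_same (n : ℕ) (d : D) : (sg C n d).1 n = d := by simp [sg]

lemma sg_ne {n k : ℕ} (h : k ≠ n) (d : D) : (sg C n d).1 k = 0 := by simp [sg, h]

/-- The projection to the `n`-th component. -/
def pr (C : Subring D) (n : ℕ) : eventuallyConstantSubring D C →+* D :=
  (Pi.evalRingHom (fun _ : ℕ => D) n).comp (eventuallyConstantSubring D C).subtype

lemma pr_apply (n : ℕ) (x : eventuallyConstantSubring D C) : pr C n x = x.1 n := rfl

lemma ext_pr {x y : eventuallyConstantSubring D C} (h : ∀ n, pr C n x = pr C n y) : x = y :=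
  Subtype.ext (funext h)

lemma pr_sg_same (n : ℕ) (d : D) : pr C n (sg C n d) = d := sg_same (C := C) n d

lemma pr_sg_ne {n k : ℕ} (h : k ≠ n) (d : D) : pr C k (sg C n d) = 0 := sg_ne (C := C) h d

lemma pr_mem {x : eventuallyConstantSubring D C}
    (hx : x ∈ (⊥ : Ideal (eventuallyConstantSubring D C)).jacobson) (n : ℕ) :
    pr C n x ∈ (⊥ : Ideal D).jacobson := by
  rw [Ideal.mem_jacobson_iff] at hx ⊢
  intro y
  obtain ⟨z, hz⟩ := hx (sg C n y)
  refine ⟨pr C n z, ?_⟩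
  rw [Ideal.mem_bot] at hz ⊢
  have := congrArg (pr C n) hz
  simpa [pr_sg_same] using this

lemma mem_of_supp {x : eventuallyConstantSubring D C} (n : ℕ)
    (h0 : ∀ k, k ≠ n → pr C k x = 0) (hn : pr C n x ∈ (⊥ : Ideal D).jacobson) :
    x ∈ (⊥ : Ideal (eventuallyConstantSubring D C)).jacobson := by
  rw [Ideal.mem_jacobson_iff] at hn ⊢
  intro y
  obtain ⟨z, hz⟩ := hn (pr C n y)
  refine ⟨1 + sg C n (z - 1), ?_⟩
  rw [Ideal.mem_bot] at hz ⊢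
  apply ext_pr
  intro k
  by_cases hk : k = n
  · subst hk
    simpa [pr_sg_same] using hz
  · simp [pr_sg_ne hk, h0 k hk]

lemma exists_poly {A B : Type*} [Ring A] [Ring B] (f : Polynomial A) (e : A → B) (he : e 0 = 0) :
    ∃ p : Polynomial B, ∀ i, p.coeff i = e (f.coeff i) := by
  refine ⟨∑ i ∈ f.support, Polynomial.monomial i (e (f.coeff i)), fun i => ?_⟩
  simp only [Polynomial.finsetSum_coeff, Polynomial.coeff_monomial]
  rw [Finset.sum_ite_eq']
  split_ifs with h
  · rfl
  · rw [Polynomial.notMem_support_iff.mp h, he]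

end ECS

/-- `D` is right J-McCoy if and only if the ring `R(D,C)` of eventually constant sequences
in `D` with eventual value in the subring `C` is right J-McCoy. -/
theorem isRightJMcCoy_iff_eventuallyConstantSubring (D : Type*) [Ring D] (C : Subring D) :
    IsRightJMcCoy D ↔ IsRightJMcCoy (eventuallyConstantSubring D C) := by
  constructor
  · intro H f g hf hg hfg
    obtain ⟨n, hn⟩ : ∃ n, g.map (ECS.pr C n) ≠ 0 := by
      by_contra! h
      apply hg
      ext1 i
      apply ECS.ext_pr
      intro n
      have := congrArg (fun p => p.coeff i) (h n)
      simpa using this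
    have hD : (1 : D) ≠ 0 := by
      intro h
      apply hn
      ext i
      rw [← mul_one (Polynomial.coeff _ i), h]
      simp
    obtain ⟨r, hr, hr'⟩ : ∃ r : D, r ≠ 0 ∧
        ∀ i : ℕ, (f.map (ECS.pr C n)).coeff i * r ∈ (⊥ : Ideal D).jacobson := by
      by_cases hfn : f.map (ECS.pr C n) = 0
      · exact ⟨1, hD, fun i => by simp [hfn]⟩
      · exact H _ _ hfn hn (by rw [← Polynomial.map_mul, hfg, Polynomial.map_zero])
    refine ⟨ECS.sg C n r, ?_, fun i => ?_⟩
    · intro h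
      apply hr
      have := congrArg (ECS.pr C n) h
      simpa [ECS.pr_sg_same] using this
    · apply ECS.mem_of_supp n
      · intro k hk
        simp [ECS.pr_sg_ne hk]
      · simpa [ECS.pr_sg_same] using hr' i
  · intro H f g hf hg hfg
    obtain ⟨p, hp⟩ := ECS.exists_poly f (ECS.sg C 0) (by ext; simp [ECS.sg])
    obtain ⟨q, hq⟩ := ECS.exists_poly g (ECS.sg C 0) (by ext; simp [ECS.sg])
    have hg0 : q ≠ 0 := by
      intro h
      apply hg
      ext i
      have := congrArg (ECS.pr C 0) (hq i)
      simpa [ECS.pr_sg_same, h] using this.symm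
    have hD : (1 : D) ≠ 0 := by
      intro h
      apply hf
      ext i
      rw [← mul_one (Polynomial.coeff _ i), h]
      simp
    set p' := p + Polynomial.C (1 - ECS.sg C 0 1) with hp'
    have hp0 : ∀ i, ECS.pr C 0 (p'.coeff i) = f.coeff i := by
      intro i
      by_cases hi : i = 0 <;>
        simp [hp', hp, ECS.pr_sg_same, Polynomial.coeff_C, Polynomial.coeff_one, hi]
    have hp1 : ∀ k, k ≠ 0 → ECS.pr C k (p'.coeff 0) = 1 := by
      intro k hk
      simp [hp', hp, ECS.pr_sg_ne hk]
    obtain ⟨r, hr, hr'⟩ := H p' q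
      (by
        intro h
        apply hD
        rw [← hp1 1 one_ne_zero, h]
        simp) hg0
      (by
        ext1 i
        apply ECS.ext_pr
        intro k
        rw [Polynomial.coeff_mul, map_sum]
        by_cases hk : k = 0
        · subst hk
          have := congrArg (fun p => p.coeff i) hfg
          simpa [hp0, hq, ECS.pr_sg_same, Polynomial.coeff_mul] using this
        · simp [hq, ECS.pr_sg_ne hk])
    obtain ⟨n, hn⟩ : ∃ n, ECS.pr C n r ≠ 0 := by
      by_contra! h
      exact hr (ECS.ext_pr (by simpa using h))
    refine ⟨ECS.pr C n r, hn, fun i => ?_⟩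
    by_cases h : n = 0
    · subst h
      have := ECS.pr_mem (hr' i) 0
      rwa [map_mul, hp0] at this
    · have := ECS.pr_mem (hr' 0) n
      rw [map_mul, hp1 n h, one_mul] at this
      exact Ideal.mul_mem_left _ _ this
end

section
/- Let R be a ring. If the polynomial ring R[x] is right J-McCoy, then R is right J-McCoy. -/
open Polynomial TensorProduct in
theorem jm_map {S T : Type*} [Ring S] [Ring T] (f : S →+* T) (hf : Function.Surjective f)
    {x : S} (hx : x ∈ (⊥ : Ideal S).jacobson) : f x ∈ (⊥ : Ideal T).jacobson := by
  rw [Ideal.mem_jacobson_iff] at hx ⊢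
  intro y
  obtain ⟨y, rfl⟩ := hf y
  obtain ⟨z, hz⟩ := hx y
  refine ⟨f z, ?_⟩
  rw [Ideal.mem_bot] at hz ⊢
  rw [← map_mul, ← map_mul, ← map_add, ← map_one f, ← map_sub, hz, map_zero]

open TensorProduct in
theorem jm_retract {R A : Type*} [Ring R] [CommRing A] (π : A →ₗ[ℤ] ℤ) (hπ : π 1 = 1) {x : R}
    (hx : x ⊗ₜ[ℤ] (1 : A) ∈ (⊥ : Ideal (R ⊗[ℤ] A)).jacobson) : x ∈ (⊥ : Ideal R).jacobson := by
  rw [Ideal.mem_jacobson_iff] at hx ⊢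
  intro y
  obtain ⟨z, hz⟩ := hx (y ⊗ₜ 1)
  let E : R ⊗[ℤ] A →ₗ[ℤ] R := (TensorProduct.rid ℤ R).toLinearMap ∘ₗ (LinearMap.lTensor R π)
  have hEt : ∀ (a : R) (b : A), E (a ⊗ₜ b) = π b • a := fun a b => by
    change TensorProduct.rid ℤ R (LinearMap.lTensor R π (a ⊗ₜ b)) = _
    rw [LinearMap.lTensor_tmul, TensorProduct.rid_tmul]
  have hE : ∀ (z : R ⊗[ℤ] A) (r : R), E (z * r ⊗ₜ 1) = E z * r := by
    intro z r
    induction z with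
    | zero => simp
    | add a b ha hb => rw [add_mul, map_add, ha, hb, map_add, add_mul]
    | tmul a b => rw [Algebra.TensorProduct.tmul_mul_tmul, mul_one, hEt, hEt, smul_mul_assoc]
  refine ⟨E z, ?_⟩
  rw [Ideal.mem_bot] at hz ⊢
  have := congrArg E hz
  rw [map_sub, map_add, hE, hE, map_zero, Algebra.TensorProduct.one_def, hEt, hπ, one_smul] at this
  exact this

open TensorProduct in
noncomputable def jmPhi (R : Type*) {A : Type*} [Ring R] [CommRing A] (a : A) :
    Polynomial R →+* R ⊗[ℤ] A :=
  Polynomial.eval₂RingHom' (Algebra.TensorProduct.includeLeftRingHom) (1 ⊗ₜ a)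
    (fun r => by simp [Commute, SemiconjBy])

open TensorProduct in
theorem jmPhi_eq (R : Type*) {A : Type*} [Ring R] [CommRing A] (a : A) (q : Polynomial R) :
    jmPhi R a q = ∑ j ∈ q.support, q.coeff j ⊗ₜ[ℤ] (a ^ j) := by
  change Polynomial.eval₂ _ _ q = _
  rw [Polynomial.eval₂_eq_sum, Polynomial.sum]
  simp [Algebra.TensorProduct.tmul_pow]

open TensorProduct in
theorem jmPhi_surj (R : Type*) {g : Polynomial ℤ} [Ring R] (a : AdjoinRoot g)
    (k : ℕ) (hk : a ^ k = AdjoinRoot.root g) : Function.Surjective (jmPhi R a) := by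
  rw [← RingHom.range_eq_top, eq_top_iff]
  have hX : ∀ a : AdjoinRoot g, jmPhi R a Polynomial.X = 1 ⊗ₜ a := fun a => by
    change Polynomial.eval₂ _ _ _ = _
    simp
  have hC : ∀ r : R, jmPhi R a (Polynomial.C r) = r ⊗ₜ 1 := fun r => by
    change Polynomial.eval₂ _ _ _ = _
    simp
  have h1 : ∀ b : AdjoinRoot g, (1 : R) ⊗ₜ[ℤ] b ∈ (jmPhi R a).range := by
    intro b
    obtain ⟨P, rfl⟩ := AdjoinRoot.mk_surjective b
    have hr : (1 : R) ⊗ₜ[ℤ] AdjoinRoot.root g ∈ (jmPhi R a).range :=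
      ⟨Polynomial.X ^ k, by rw [map_pow, hX, Algebra.TensorProduct.tmul_pow, hk, one_pow]⟩
    let i : AdjoinRoot g →+* R ⊗[ℤ] AdjoinRoot g :=
      (Algebra.TensorProduct.includeRight : AdjoinRoot g →ₐ[ℤ] R ⊗[ℤ] AdjoinRoot g).toRingHom
    change i (AdjoinRoot.mk g P) ∈ _
    induction P using Polynomial.induction_on' with
    | add p q hp hq => rw [map_add, map_add]; exact add_mem hp hq
    | monomial n c =>
      rw [← Polynomial.C_mul_X_pow_eq_monomial, map_mul, map_pow, AdjoinRoot.mk_X, map_mul, map_pow]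
      refine mul_mem ?_ (pow_mem hr n)
      rw [show Polynomial.C c = (c : Polynomial ℤ) by simp, map_intCast, map_intCast]
      exact intCast_mem _ c
  intro t _
  induction t with
  | zero => exact zero_mem _
  | add x y hx hy => exact add_mem (hx trivial) (hy trivial)
  | tmul r b =>
    have : r ⊗ₜ[ℤ] b = (r ⊗ₜ 1) * (1 ⊗ₜ b) := by simp
    rw [this]
    exact mul_mem ⟨_, hC r⟩ (h1 b)

open TensorProduct in
theorem jm_prime {R : Type*} [Ring R] {q : Polynomial R}
    (hq : q ∈ (⊥ : Ideal (Polynomial R)).jacobson) (p : ℕ) (hp : p.Prime)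
    (hd : q.natDegree < p) (m : ℕ) (hm : m < p) :
    (p : R) * q.coeff m ∈ (⊥ : Ideal R).jacobson := by
  have := Fact.mk hp
  set g := Polynomial.cyclotomic p ℤ with hg
  have hmon : g.Monic := Polynomial.cyclotomic.monic p ℤ
  have hirr : Irreducible g := Polynomial.cyclotomic.irreducible hp.pos
  have : IsDomain (AdjoinRoot g) := AdjoinRoot.isDomain_of_prime hirr.prime
  let ζ := AdjoinRoot.root g
  let B := AdjoinRoot.powerBasis' hmon
  have hdim : 0 < B.dim := by
    change 0 < g.natDegree
    rw [hg, Polynomial.natDegree_cyclotomic]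
    exact Nat.totient_pos.2 hp.pos
  let π : AdjoinRoot g →ₗ[ℤ] ℤ := B.basis.coord ⟨0, hdim⟩
  have hπ : π 1 = 1 := by
    have : B.basis ⟨0, hdim⟩ = 1 := by simp
    rw [← this, Module.Basis.coord_apply, Module.Basis.repr_self, Finsupp.single_eq_same]
  have hsum : ∑ i ∈ Finset.range p, ζ ^ i = 0 := by
    have h0 : AdjoinRoot.mk g g = 0 := AdjoinRoot.mk_self
    have h1 : g = ∑ i ∈ Finset.range p, Polynomial.X ^ i := Polynomial.cyclotomic_prime ℤ p
    rw [congrArg (AdjoinRoot.mk g) h1, map_sum] at h0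
    simpa only [map_pow, AdjoinRoot.mk_X] using h0
  have hζp : ζ ^ p = 1 := by
    have := geom_sum_mul ζ p
    rw [hsum, zero_mul] at this
    exact (sub_eq_zero.1 this.symm)
  have hζ1 : ζ ≠ 1 := by
    intro h
    rw [h] at hsum
    simp only [one_pow, Finset.sum_const, Finset.card_range] at hsum
    have := congrArg π hsum
    rw [map_nsmul, hπ, map_zero] at this
    simp at this
    exact hp.ne_zero this
  have hprim : IsPrimitiveRoot ζ p := by
    have := orderOf_eq_prime hζp hζ1
    rw [← this]
    exact IsPrimitiveRoot.orderOf ζ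
  have hk : ∀ k : ℕ, ∑ s ∈ Finset.range p, (ζ ^ s) ^ k = if p ∣ k then (p : AdjoinRoot g) else 0 := by
    intro k
    split_ifs with h
    · have : ζ ^ k = 1 := (hprim.pow_eq_one_iff_dvd k).2 h
      simp [← pow_mul, mul_comm _ k, pow_mul ζ k, this]
    · have h2 := (hprim.pow_of_coprime k ((hp.coprime_iff_not_dvd.2 h).symm)).geom_sum_eq_zero
        hp.one_lt
      rw [← h2]
      exact Finset.sum_congr rfl fun s _ => by rw [← pow_mul, ← pow_mul, mul_comm]
  -- the twisted sum
  let t : ℕ → R ⊗[ℤ] AdjoinRoot g := fun s => (1 ⊗ₜ ((ζ ^ s) ^ (p - m))) * jmPhi R (ζ ^ s) q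
  have ht : ∀ s, t s = ∑ j ∈ q.support, q.coeff j ⊗ₜ[ℤ] ((ζ ^ s) ^ (j + (p - m))) := by
    intro s
    simp only [t]
    rw [jmPhi_eq, Finset.mul_sum]
    refine Finset.sum_congr rfl fun j _ => ?_
    rw [Algebra.TensorProduct.tmul_mul_tmul, one_mul, ← pow_add, add_comm]
  have htot : ∑ s ∈ Finset.range p, t s = ((p : R) * q.coeff m) ⊗ₜ[ℤ] 1 := by
    simp only [ht]
    rw [Finset.sum_comm]
    simp only [← TensorProduct.tmul_sum, hk]
    rw [Finset.sum_eq_single m]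
    · rw [if_pos (by rw [Nat.add_sub_cancel' hm.le]), ← nsmul_eq_mul, ← nsmul_one p,
        TensorProduct.tmul_smul, TensorProduct.smul_tmul']
    · intro j hj hjm
      have hjp : j < p := (Polynomial.le_natDegree_of_mem_supp j hj).trans_lt hd
      rw [if_neg, TensorProduct.tmul_zero]
      rintro ⟨c, hc⟩
      have : c = 1 := by
        have h1 : c < 2 := by
          by_contra h
          have := Nat.mul_le_mul_left p (not_lt.1 h)
          omega
        have h2 : c ≠ 0 := by
          rintro rfl
          omega
        omega
      subst this
      omega
    · intro h
      rw [Polynomial.notMem_support_iff.1 h, TensorProduct.zero_tmul]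
  have ht0 : t 0 = (q.eval 1) ⊗ₜ[ℤ] 1 := by
    rw [ht, Polynomial.eval_eq_sum, Polynomial.sum, TensorProduct.sum_tmul]
    simp
  have h1 : q.eval 1 ∈ (⊥ : Ideal R).jacobson := by
    have := jm_map (Polynomial.eval₂RingHom' (RingHom.id R) 1 (fun r => Commute.one_right r))
      (fun r => ⟨Polynomial.C r, by change Polynomial.eval₂ _ _ _ = _; simp⟩) hq
    exact this
  have hrest : ∑ s ∈ Finset.range (p - 1), t (s + 1) ∈ (⊥ : Ideal (R ⊗[ℤ] AdjoinRoot g)).jacobson := by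
    refine Ideal.sum_mem _ fun s hs => ?_
    refine Ideal.mul_mem_left _ _ (jm_map _ ?_ hq)
    have hs' := Finset.mem_range.1 hs
    have hc : Nat.Coprime (s + 1) p :=
      Nat.Coprime.symm (hp.coprime_iff_not_dvd.2 fun hdv => by
        have := Nat.le_of_dvd (Nat.succ_pos s) hdv
        omega)
    obtain ⟨k, -, hk⟩ := Nat.exists_mul_mod_eq_one_of_coprime hc hp.one_lt
    refine jmPhi_surj R _ k ?_
    rw [← pow_mul, ← Nat.div_add_mod ((s + 1) * k) p, hk, pow_add, pow_mul, hζp, one_pow, one_mul,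
      pow_one]
  have h2 : ((p : R) * q.coeff m - q.eval 1) ⊗ₜ[ℤ] (1 : AdjoinRoot g) ∈
      (⊥ : Ideal (R ⊗[ℤ] AdjoinRoot g)).jacobson := by
    rw [TensorProduct.sub_tmul, ← htot, ← ht0]
    have : Finset.range p = Finset.range ((p - 1) + 1) := by
      rw [Nat.sub_add_cancel hp.one_lt.le]
    rw [this, Finset.sum_range_succ', add_sub_cancel_right]
    exact hrest
  have h3 := add_mem (jm_retract π hπ h2) h1
  rwa [sub_add_cancel] at h3

theorem jm_coeff {R : Type*} [Ring R] {q : Polynomial R}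
    (hq : q ∈ (⊥ : Ideal (Polynomial R)).jacobson) (m : ℕ) :
    q.coeff m ∈ (⊥ : Ideal R).jacobson := by
  obtain ⟨p, hp, hpp⟩ := Nat.exists_infinite_primes (q.natDegree + m + 1)
  obtain ⟨l, hl, hlp⟩ := Nat.exists_infinite_primes (p + 1)
  have h1 := jm_prime hq p hpp (by omega) m (by omega)
  have h2 := jm_prime hq l hlp (by omega) m (by omega)
  have hc : IsCoprime (p : ℤ) (l : ℤ) :=
    Nat.isCoprime_iff_coprime.2 ((Nat.coprime_primes hpp hlp).2 (by omega))
  obtain ⟨a, b, hab⟩ := hc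
  have h3 := add_mem (Ideal.mul_mem_left _ (a : R) h1) (Ideal.mul_mem_left _ (b : R) h2)
  have h4 : (a : R) * p + b * l = 1 := by exact_mod_cast congrArg (Int.cast : ℤ → R) hab
  rwa [← mul_assoc, ← mul_assoc, ← add_mul, h4, one_mul] at h3

/-- If the polynomial ring `R[x]` is right J-McCoy, then `R` is right J-McCoy. -/
theorem isRightJMcCoy_of_polynomial (R : Type*) [Ring R]
    (h : IsRightJMcCoy (Polynomial R)) : IsRightJMcCoy R := by
  intro f g hf hg hfg
  have hinj := Polynomial.map_injective (Polynomial.C : R →+* Polynomial R) Polynomial.C_injective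
  obtain ⟨c, hc, hfc⟩ := h (f.map Polynomial.C) (g.map Polynomial.C)
    (fun h0 => hf (hinj (by rw [h0, Polynomial.map_zero])))
    (fun h0 => hg (hinj (by rw [h0, Polynomial.map_zero])))
    (by rw [← Polynomial.map_mul, hfg, Polynomial.map_zero])
  refine ⟨c.leadingCoeff, Polynomial.leadingCoeff_ne_zero.2 hc, fun i => ?_⟩
  have := jm_coeff (hfc i) c.natDegree
  rwa [Polynomial.coeff_map, Polynomial.coeff_C_mul] at this
end

section
/- Let R be a ring. If the polynomial ring R[x] is left J-McCoy, then R is left J-McCoy. -/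
/-- Maschke-type argument: a cyclic group of invertible order acting on a semisimple module. -/
lemma semisimple_poly {R M : Type*} [Ring R] [AddCommGroup M] [Module R M]
    [Module (Polynomial R) M] (hC : ∀ (a : R) (m : M), (Polynomial.C a : Polynomial R) • m = a • m)
    [IsSemisimpleModule R M] (n : ℕ)
    (hX : ∀ m : M, ((Polynomial.X : Polynomial R) ^ n) • m = m)
    (hn : Function.Bijective (fun m : M => n • m)) :
    IsSemisimpleModule (Polynomial R) M := by
  rw [isSemisimpleModule_iff]
  refine ⟨fun N => ?_⟩
  let N' : Submodule R M :=
    { N.toAddSubmonoid with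
      smul_mem' := fun a m hm => by
        rw [← hC]
        exact N.smul_mem _ hm }
  have hN' : ∀ m, m ∈ N' ↔ m ∈ N := fun m => Iff.rfl
  obtain ⟨W, hW⟩ := exists_isCompl N'
  obtain ⟨π, hπN, hπ⟩ : ∃ π : M →ₗ[R] M, (∀ m, π m ∈ N) ∧ ∀ m ∈ N, π m = m := by
    refine ⟨N'.subtype ∘ₗ N'.projectionOnto W hW, fun m => ?_, fun m hm => ?_⟩
    · exact (N'.projectionOnto W hW m).2
    · have := Submodule.projectionOnto_apply_left hW ⟨m, hm⟩
      exact congrArg Subtype.val this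
  let F : M → M := fun m => ∑ k ∈ Finset.range n,
    (Polynomial.X : Polynomial R) ^ k • π ((Polynomial.X : Polynomial R) ^ (n - k) • m)
  have Fadd : ∀ a b, F (a + b) = F a + F b := by
    intro a b
    simp [F, smul_add, Finset.sum_add_distrib]
  have comm : ∀ (a : R) (k : ℕ) (m : M), (Polynomial.X : Polynomial R) ^ k • a • m =
      a • (Polynomial.X : Polynomial R) ^ k • m := by
    intro a k m
    rw [← hC, ← hC, smul_smul, smul_smul, Polynomial.X_pow_mul]
  have FC : ∀ (a : R) m, F (a • m) = a • F m := by
    intro a m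
    simp only [F, Finset.smul_sum, comm, map_smul]
  have FX : ∀ m, F ((Polynomial.X : Polynomial R) • m) = (Polynomial.X : Polynomial R) • F m := by
    intro m
    let g : ℕ → M := fun k =>
      (Polynomial.X : Polynomial R) ^ k • π ((Polynomial.X : Polynomial R) ^ (n + 1 - k) • m)
    have h1 : F ((Polynomial.X : Polynomial R) • m) = ∑ k ∈ Finset.range n, g k := by
      refine Finset.sum_congr rfl fun k hk => ?_
      have hk := Finset.mem_range.1 hk
      simp only [g]
      rw [smul_smul, ← pow_succ]
      congr 4
      omega
    have h2 : (Polynomial.X : Polynomial R) • F m = ∑ k ∈ Finset.range n, g (k + 1) := by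
      simp only [F, Finset.smul_sum]
      refine Finset.sum_congr rfl fun k hk => ?_
      simp only [g]
      rw [smul_smul, ← pow_succ']
      congr 4
      omega
    have h3 := Finset.sum_range_succ g n
    rw [Finset.sum_range_succ'] at h3
    have h4 : g 0 = g n := by
      simp only [g, hX]
      simp [pow_succ', mul_smul, hX]
    rw [h4] at h3
    rw [h1, h2, add_right_cancel h3]
  let P : M →ₗ[Polynomial R] M :=
    { toFun := F
      map_add' := Fadd
      map_smul' := by
        intro p m
        simp only [RingHom.id_apply]
        induction p using Polynomial.induction_on' generalizing m with
        | add p q hp hq => rw [add_smul, Fadd, hp, hq, add_smul]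
        | monomial k a =>
          rw [← Polynomial.C_mul_X_pow_eq_monomial, mul_smul, mul_smul, hC, hC, FC]
          congr 1
          induction k generalizing m with
          | zero => simp
          | succ k ih => rw [pow_succ, mul_smul, mul_smul, ih, FX] }
  have hPN : ∀ m, P m ∈ N := by
    intro m
    change ∑ k ∈ Finset.range n, _ ∈ N
    exact N.sum_mem fun k _ => N.smul_mem _ (hπN _)
  have hP : ∀ m ∈ N, P m = n • m := by
    intro m hm
    have : ∀ k ∈ Finset.range n, (Polynomial.X : Polynomial R) ^ k •
        π ((Polynomial.X : Polynomial R) ^ (n - k) • m) = m := by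
      intro k hk
      have hk := Finset.mem_range.1 hk
      rw [hπ _ (N.smul_mem _ hm), smul_smul, ← pow_add, Nat.add_sub_cancel' hk.le, hX]
    change ∑ k ∈ Finset.range n, _ = _
    rw [Finset.sum_congr rfl this]
    simp
  let e : M ≃ₗ[Polynomial R] M :=
    LinearEquiv.ofBijective (n • (LinearMap.id : M →ₗ[Polynomial R] M)) hn
  have he : ∀ m, n • e.symm m = m := fun m => e.apply_symm_apply m
  let Q : M →ₗ[Polynomial R] N := (P ∘ₗ e.symm.toLinearMap).codRestrict N fun m => hPN _
  refine ⟨_, LinearMap.isCompl_of_proj (f := Q) fun x => ?_⟩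
  apply Subtype.ext
  apply hn.1
  change n • P (e.symm (x : M)) = n • (x : M)
  rw [← map_nsmul, he, hP _ x.2]

lemma coeff_smul_eq_zero {R V : Type*} [Ring R] [AddCommGroup V] [Module R V]
    [IsSemisimpleModule R V] (n : ℕ) [NeZero n] (hn : Function.Bijective (fun v : V => n • v))
    (p : Polynomial R) (hp : p ∈ Ring.jacobson (Polynomial R)) (hd : p.natDegree < n) (i : ℕ)
    (v : V) : p.coeff i • v = 0 := by
  let s : Module.End R (ZMod n → V) := LinearMap.funLeft R V (fun i => i - 1)
  have hs : ∀ m i, s m i = m (i - 1) := fun _ _ => rfl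
  let φ : Polynomial R →+* AddMonoid.End (ZMod n → V) :=
    Polynomial.eval₂RingHom' (Module.toAddMonoidEnd R (ZMod n → V)) s.toAddMonoidHom (by
      intro a
      ext m i
      rfl)
  letI : Module (Polynomial R) (ZMod n → V) := Module.compHom _ φ
  have hφ : ∀ (p : Polynomial R) (m : ZMod n → V), p • m = φ p m := fun _ _ => rfl
  have hC : ∀ (a : R) (m : ZMod n → V), (Polynomial.C a : Polynomial R) • m = a • m := by
    intro a m
    rw [hφ]
    exact DFunLike.congr_fun (Polynomial.eval₂_C (Module.toAddMonoidEnd R (ZMod n → V))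
      (x := (s.toAddMonoidHom : AddMonoid.End (ZMod n → V)))) m
  have hX1 : ∀ (m : ZMod n → V), (Polynomial.X : Polynomial R) • m = s m := by
    intro m
    rw [hφ]
    exact DFunLike.congr_fun (Polynomial.eval₂_X (Module.toAddMonoidEnd R (ZMod n → V))
      (x := (s.toAddMonoidHom : AddMonoid.End (ZMod n → V)))) m
  have hXk : ∀ (k : ℕ) (m : ZMod n → V) j, ((Polynomial.X : Polynomial R) ^ k • m) j = m (j - k) := by
    intro k
    induction k with
    | zero => simp
    | succ k ih =>
      intro m j
      rw [pow_succ, mul_smul, ih, hX1, hs]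
      congr 1
      push_cast
      ring
  have hss : IsSemisimpleModule (Polynomial R) (ZMod n → V) := by
    refine semisimple_poly hC n ?_ ?_
    · intro m
      ext j
      rw [hXk]
      simp
    · constructor
      · intro a b hab
        ext j
        exact hn.1 (congrFun hab j)
      · intro a
        choose b hb using fun j => hn.2 (a j)
        exact ⟨b, funext hb⟩
  have hz : p • (Pi.single 0 v : ZMod n → V) = 0 :=
    Module.mem_annihilator.1
      (IsSemisimpleModule.jacobson_le_annihilator (Polynomial R) (ZMod n → V) hp) _
  rcases lt_or_ge p.natDegree i with hi | hi
  · rw [Polynomial.coeff_eq_zero_of_natDegree_lt hi, zero_smul]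
  have h1 := congrFun hz (i : ZMod n)
  rw [p.as_sum_range_C_mul_X_pow, Finset.sum_smul, Finset.sum_apply] at h1
  simp only [mul_smul, hC, Pi.smul_apply, hXk] at h1
  rw [Finset.sum_eq_single i] at h1
  · simpa using h1
  · intro k hk hki
    have hk := Finset.mem_range.1 hk
    rw [Pi.single_eq_of_ne, smul_zero]
    intro h0
    rw [sub_eq_zero, ZMod.natCast_eq_natCast_iff', Nat.mod_eq_of_lt (by omega),
      Nat.mod_eq_of_lt (by omega)] at h0
    exact hki h0.symm
  · intro hh
    exact absurd (Finset.mem_range.2 (by omega)) hh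

lemma coeff_mem_jacobson {R : Type*} [Ring R] (p : Polynomial R)
    (hp : p ∈ Ring.jacobson (Polynomial R)) (i : ℕ) : p.coeff i ∈ (⊥ : Ideal R).jacobson := by
  rw [Ideal.jacobson, Ideal.mem_sInf]
  rintro m ⟨-, hm⟩
  have hsimp : IsSimpleModule R (R ⧸ m) := isSimpleModule_iff_isCoatom.2 hm.out
  obtain ⟨n, hn0, hd, hn⟩ : ∃ n : ℕ, n ≠ 0 ∧ p.natDegree < n ∧
      Function.Bijective (fun v : R ⧸ m => n • v) := by
    rcases LinearMap.bijective_or_eq_zero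
      ((p.natDegree + 1) • (LinearMap.id : (R ⧸ m) →ₗ[R] (R ⧸ m))) with h | h
    · exact ⟨p.natDegree + 1, by omega, by omega, h⟩
    · refine ⟨p.natDegree + 1 + 1, by omega, by omega, ?_⟩
      have : (fun v : R ⧸ m => (p.natDegree + 1 + 1) • v) = id := by
        ext v
        have := LinearMap.congr_fun h v
        change (p.natDegree + 1) • v = 0 at this
        rw [succ_nsmul, this, zero_add, id]
      rw [this]
      exact Function.bijective_id
  haveI : NeZero n := ⟨hn0⟩
  have := coeff_smul_eq_zero n hn p hp hd i (Submodule.Quotient.mk (p := m) 1)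
  rw [← Submodule.Quotient.mk_smul, Submodule.Quotient.mk_eq_zero] at this
  simpa using this

/-- If the polynomial ring `R[x]` is left J-McCoy, then `R` is left J-McCoy. -/
theorem isLeftJMcCoy_of_polynomial (R : Type*) [Ring R]
    (h : IsLeftJMcCoy (Polynomial R)) : IsLeftJMcCoy R := by
  intro f g hf hg hfg
  have hinj := Polynomial.map_injective (Polynomial.C : R →+* Polynomial R) Polynomial.C_injective
  obtain ⟨r, hr, hrg⟩ := h (f.map Polynomial.C) (g.map Polynomial.C)
    (fun h0 => hf (hinj (by simpa using h0))) (fun h0 => hg (hinj (by simpa using h0)))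
    (by rw [← Polynomial.map_mul, hfg, Polynomial.map_zero])
  refine ⟨r.leadingCoeff, by simpa using hr, fun j => ?_⟩
  have := hrg j
  rw [Ideal.jacobson_bot, Polynomial.coeff_map] at this
  simpa using coeff_mem_jacobson _ this r.natDegree
end

section
/- Let R be a right J-McCoy ring such that J(R)[x] ⊆ J(R[x]), i.e., every polynomial all of whose coefficients lie in J(R) belongs to the Jacobson radical of the polynomial ring R[x]. Then the polynomial ring R[x] is right J-McCoy. -/
theorem exists_bound_aux {R : Type*} [Ring R] (F : Polynomial (Polynomial R)) :
    ∃ k : ℕ, ∀ i, (F.coeff i).natDegree ≤ k := by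
  refine ⟨F.support.sup fun i => (F.coeff i).natDegree, fun i => ?_⟩
  by_cases h : i ∈ F.support
  · exact Finset.le_sup (f := fun i => (F.coeff i).natDegree) h
  · rw [Polynomial.notMem_support_iff.mp h]
    simp

theorem coeff_eval_aux {R : Type*} [Ring R] (F : Polynomial (Polynomial R)) (k : ℕ)
    (hk : ∀ i, (F.coeff i).natDegree < k) (i j : ℕ) (hj : j < k) :
    (F.eval (Polynomial.X ^ k)).coeff (k * i + j) = (F.coeff i).coeff j := by
  rw [Polynomial.eval_eq_sum_range, Polynomial.finset_sum_coeff]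
  rw [Finset.sum_eq_single i]
  · rw [← pow_mul, Polynomial.coeff_mul_X_pow', if_pos (Nat.le_add_right _ _)]
    simp
  · intro e _ he
    rw [← pow_mul, Polynomial.coeff_mul_X_pow']
    split_ifs with h
    · apply Polynomial.coeff_eq_zero_of_natDegree_lt
      refine (hk e).trans_le ?_
      rcases lt_or_gt_of_ne he with h1 | h1
      · have : k * (e + 1) ≤ k * i := Nat.mul_le_mul_left k h1
        rw [Nat.mul_add] at this
        omega
      · have : k * (i + 1) ≤ k * e := Nat.mul_le_mul_left k h1
        rw [Nat.mul_add] at this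
        omega
    · rfl
  · intro h
    have : F.coeff i = 0 := by
      apply Polynomial.coeff_eq_zero_of_natDegree_lt
      simpa using h
    simp [this]

theorem eval_ne_zero_aux {R : Type*} [Ring R] (F : Polynomial (Polynomial R)) (k : ℕ)
    (hk : ∀ i, (F.coeff i).natDegree < k) (hF : F ≠ 0) :
    F.eval (Polynomial.X ^ k) ≠ 0 := by
  intro h
  apply hF
  ext i j
  rcases lt_or_ge j k with hj | hj
  · rw [← coeff_eval_aux F k hk i j hj, h]
    simp
  · rw [Polynomial.coeff_eq_zero_of_natDegree_lt ((hk i).trans_le hj)]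
    simp

/-- If `R` is right J-McCoy and `J(R)[x] ⊆ J(R[x])`, then `R[x]` is right J-McCoy. -/
theorem isRightJMcCoy_polynomial (R : Type*) [Ring R] (hR : IsRightJMcCoy R)
    (hJ : ∀ p : Polynomial R, (∀ i : ℕ, p.coeff i ∈ (⊥ : Ideal R).jacobson) →
      p ∈ (⊥ : Ideal (Polynomial R)).jacobson) :
    IsRightJMcCoy (Polynomial R) := by
  intro F G hF hG hFG
  obtain ⟨a, ha⟩ := exists_bound_aux F
  obtain ⟨b, hb⟩ := exists_bound_aux G
  have hkF : ∀ i, (F.coeff i).natDegree < a + b + 1 := fun i => by have := ha i; omega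
  have hkG : ∀ i, (G.coeff i).natDegree < a + b + 1 := fun i => by have := hb i; omega
  have hmul : F.eval (Polynomial.X ^ (a + b + 1)) * G.eval (Polynomial.X ^ (a + b + 1)) = 0 := by
    have := Polynomial.eval₂_mul_noncomm (p := F) (q := G) (RingHom.id (Polynomial R))
      (Polynomial.X ^ (a + b + 1)) (fun i => (Polynomial.commute_X_pow _ _).symm)
    rw [hFG, Polynomial.eval₂_zero] at this
    exact this.symm
  obtain ⟨r, hr, h⟩ := hR _ _ (eval_ne_zero_aux F _ hkF hF) (eval_ne_zero_aux G _ hkG hG) hmul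
  refine ⟨Polynomial.C r, by simpa using hr, fun i => hJ _ fun j => ?_⟩
  rw [Polynomial.coeff_mul_C]
  rcases lt_or_ge j (a + b + 1) with hj | hj
  · rw [← coeff_eval_aux F _ hkF i j hj]
    exact h _
  · rw [Polynomial.coeff_eq_zero_of_natDegree_lt ((hkF i).trans_le hj), zero_mul]
    exact Ideal.zero_mem _
end

section
/- Let R be any ring and n ≥ 2. Then the ring T_n(R) of n × n upper triangular matrices over R (the subring of the full matrix ring M_n(R) consisting of all matrices A with A_{ij} = 0 whenever i > j) is right J-McCoy. -/
/-- The ring `T_n(R)` of `n × n` upper triangular matrices over `R`, as a subring of the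
full matrix ring `M_n(R)`. -/
def upperTriangularSubring (R : Type*) [Ring R] (n : ℕ) :
    Subring (Matrix (Fin n) (Fin n) R) where
  carrier := {A | ∀ i j : Fin n, j < i → A i j = 0}
  zero_mem' := fun _ _ _ => rfl
  one_mem' := fun _ _ h => Matrix.one_apply_ne h.ne'
  add_mem' := fun hA hB i j h => by simp [hA i j h, hB i j h]
  neg_mem' := fun hA i j h => by simp [hA i j h]
  mul_mem' := by
    intro A B hA hB i j hij
    rw [Matrix.mul_apply]
    apply Finset.sum_eq_zero
    intro k _
    by_cases hk : k < i
    · rw [hA i k hk, zero_mul]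
    · rw [hB k j (lt_of_lt_of_le hij (not_lt.mp hk)), mul_zero]

/-- For any ring `R` and `n ≥ 2`, the upper triangular matrix ring `T_n(R)` is
right J-McCoy. -/
theorem isRightJMcCoy_upperTriangular (R : Type*) [Ring R] (n : ℕ) (hn : 2 ≤ n) :
    IsRightJMcCoy (upperTriangularSubring R n) := by
  intro f g hf _ _
  have hR : Nontrivial R := by
    by_contra h
    rw [not_nontrivial_iff_subsingleton] at h
    apply hf
    ext i a b
    exact Subsingleton.elim _ _
  let p : Fin n := ⟨0, by omega⟩
  let q : Fin n := ⟨n - 1, by omega⟩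
  have hpq : p < q := by
    rw [Fin.lt_def]
    change 0 < n - 1
    omega
  have hmem : Matrix.single p q (1 : R) ∈ upperTriangularSubring R n := by
    intro i j hij
    rw [Matrix.single_apply, if_neg]
    rintro ⟨rfl, rfl⟩
    exact absurd hij (not_lt.mpr hpq.le)
  let r : upperTriangularSubring R n := ⟨Matrix.single p q 1, hmem⟩
  have key : ∀ b : upperTriangularSubring R n, r * b * r = 0 := by
    intro b
    apply Subtype.ext
    change Matrix.single p q (1 : R) * b.1 * Matrix.single p q 1 = 0
    rw [Matrix.single_mul_mul_single, b.2 q p hpq]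
    simp
  refine ⟨r, ?_, fun i => ?_⟩
  · intro h
    have h1 := congrArg (fun A : upperTriangularSubring R n => A.1 p q) h
    simp [r] at h1
  · rw [Ideal.mem_jacobson_iff]
    intro y
    refine ⟨1 - y * (f.coeff i * r), ?_⟩
    rw [Ideal.mem_bot]
    have h2 : y * (f.coeff i * r) * (y * (f.coeff i * r)) = 0 := by
      have := key (y * f.coeff i)
      calc _ = y * f.coeff i * (r * (y * f.coeff i) * r) := by simp only [mul_assoc]
        _ = 0 := by rw [this, mul_zero]
    rw [mul_assoc (1 - _), sub_mul, h2]
    simp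
end

section
/- Let R be any ring and M a nonzero R-bimodule. Then the trivial square-zero extension R ⊕ M, with multiplication (r, m)(r', m') = (rr', r m' + m r'), is a right J-McCoy ring. -/
/-- For any ring `R` and any nonzero `R`-bimodule `M`, the trivial square-zero extension
`R ⊕ M` (with multiplication `(r, m)(r', m') = (rr', r m' + m r')`) is right J-McCoy. -/
theorem isRightJMcCoy_trivSqZeroExt (R M : Type*) [Ring R] [AddCommGroup M]
    [Module R M] [Module Rᵐᵒᵖ M] [SMulCommClass R Rᵐᵒᵖ M] [Nontrivial M] :
    IsRightJMcCoy (TrivSqZeroExt R M) := by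
  intro f g _ _ _
  obtain ⟨m, hm⟩ := exists_ne (0 : M)
  refine ⟨TrivSqZeroExt.inr m, fun h => hm ?_, fun i => ?_⟩
  · simpa using congrArg TrivSqZeroExt.snd h
  · rw [Ideal.mem_jacobson_iff]
    intro y
    refine ⟨1 - y * (f.coeff i * TrivSqZeroExt.inr m), ?_⟩
    rw [Ideal.mem_bot]
    have key : ∀ w : TrivSqZeroExt R M, w.fst = 0 → w * w = 0 := by
      intro w hw
      ext <;> simp [hw]
    have h := key (y * (f.coeff i * TrivSqZeroExt.inr m)) (by simp)
    rw [mul_assoc, sub_mul, h]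
    simp
end

section
/- Let R be any ring and n ≥ 2. Then the quotient ring R[y]/(y^n) of the polynomial ring R[y] by the two-sided ideal generated by y^n is right J-McCoy. -/
/-- For any ring `R` and `n ≥ 2`, the quotient `R[y]/(y^n)` of the polynomial ring `R[y]`
by the two-sided ideal generated by `y^n` is right J-McCoy. -/
theorem isRightJMcCoy_polynomial_quotient_X_pow (R : Type*) [Ring R] (n : ℕ) (hn : 2 ≤ n) :
    IsRightJMcCoy
      (TwoSidedIdeal.span {(Polynomial.X : Polynomial R) ^ n}).ringCon.Quotient := by
  set I := TwoSidedIdeal.span {(Polynomial.X : Polynomial R) ^ n} with hI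
  intro f g hf _ _
  have hdvd : ∀ p : Polynomial R, p ∈ I → (Polynomial.X : Polynomial R) ^ n ∣ p := by
    intro p hp
    induction hp using TwoSidedIdeal.span_induction with
    | mem x h => rw [Set.mem_singleton_iff.mp h]
    | zero => exact dvd_zero _
    | add x y _ _ hx hy => exact dvd_add hx hy
    | neg x _ hx => exact (dvd_neg).mpr hx
    | left_absorb a x _ hx =>
      obtain ⟨q, rfl⟩ := hx
      exact ⟨a * q, by rw [← mul_assoc, ← mul_assoc, (Polynomial.commute_X_pow a n).eq]⟩
    | right_absorb b x _ hx => exact hx.mul_right b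
  let π : Polynomial R →+* I.ringCon.Quotient := I.ringCon.mk'
  have hπ : Function.Surjective π := I.ringCon.mk'_surjective
  have hker : ∀ p, π p = 0 ↔ p ∈ I := by
    intro p
    rw [← TwoSidedIdeal.mem_ker (f := π), TwoSidedIdeal.ker_ringCon_mk']
  have hXn : π Polynomial.X ^ n = 0 := by
    rw [← map_pow, hker]
    exact TwoSidedIdeal.subset_span rfl
  have hcomm : ∀ a, Commute a (π Polynomial.X) := by
    intro a
    obtain ⟨p, rfl⟩ := hπ a
    exact (Polynomial.commute_X p).symm.map π
  refine ⟨π Polynomial.X, ?_, ?_⟩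
  · intro h
    have hX := hdvd _ ((hker _).mp h)
    have h1 := Polynomial.X_pow_dvd_iff.mp hX 1 (by omega)
    rw [Polynomial.coeff_X_one] at h1
    apply hf
    ext i
    obtain ⟨p, hp⟩ := hπ (f.coeff i)
    have hp0 : p = 0 := by
      ext j
      rw [← mul_one (p.coeff j), h1, mul_zero, Polynomial.coeff_zero]
    rw [← hp, hp0, map_zero, Polynomial.coeff_zero]
  · intro i
    rw [Ideal.mem_jacobson_iff]
    intro y
    have hnil : IsNilpotent (y * (f.coeff i * π Polynomial.X)) :=
      ⟨n, by rw [← mul_assoc, (hcomm _).mul_pow, hXn, mul_zero]⟩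
    obtain ⟨u, hu⟩ := hnil.isUnit_one_add
    refine ⟨(u⁻¹ : _ˣ), ?_⟩
    have h2 := u.inv_mul
    rw [hu, mul_add, mul_one] at h2
    rw [Ideal.mem_bot, mul_assoc, add_comm, h2, sub_self]
end
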